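/- Let K be a convex body in R^d, u a unit vector, L = u^⊥, and Q the maximal (d-1)-volume of sections of K parallel to L. Suppose K attains this maximum at two distinct hyperplanes: k_-(Q) < k_+(Q) where k_±(Q) are the extreme heights at which μ_{d-1}(K ∩ (pu + L)) = Q. Then all sections K ∩ (pu + L) for p ∈ [k_-(Q), k_+(Q)] are translates of K_- := K ∩ (k_-(Q)u + L), and there exist a unit vector v and λ > 0 with ⟨v, u⟩ > 0 such that {x ∈ K : k_-(Q) ≤ ⟨x, u⟩ ≤ k_+(Q)} = K_- + [0, λv] and K ⊆ K_- + Rv. -/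

import Mathlib

open MeasureTheory Pointwise
open scoped RealInnerProductSpace

/-- The `(d-1)`-volume of the section of `K` at height `p` in direction `u`. -/
noncomputable def sectionVol (d : ℕ) (K : Set (EuclideanSpace ℝ (Fin d)))
    (u : EuclideanSpace ℝ (Fin d)) (p : ℝ) : ℝ :=
  (μH[(d : ℝ) - 1] (K ∩ {x | ⟪x, u⟫ = p})).toReal

open scoped ENNReal

/-- The one-dimensional Brunn–Minkowski inequality for compact sets. -/
theorem Real.volume_add_volume_le_of_isCompact {A B C : Set ℝ} (hA : IsCompact A)
    (hB : IsCompact B) (hAn : A.Nonempty) (hBn : B.Nonempty)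
    (h : ∀ a ∈ A, ∀ b ∈ B, a + b ∈ C) : volume A + volume B ≤ volume C := by
  have ha := hA.sSup_mem hAn
  have hb := hB.sInf_mem hBn
  set a := sSup A
  set b := sInf B
  have h1 : volume A ≤ volume (C ∩ Set.Iio (a + b)) := by
    rw [← measure_sdiff_null (s := A) (t := {a}) (by simp),
      ← measure_preimage_add_right volume b (C ∩ Set.Iio (a + b))]
    refine measure_mono fun x hx => ⟨h x hx.1 b hb, ?_⟩
    have : x ≤ a := le_csSup hA.bddAbove hx.1
    have h2 : x ≠ a := hx.2
    have := lt_of_le_of_ne this h2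
    simpa using this
  have h2 : volume B ≤ volume (C \ Set.Iio (a + b)) := by
    rw [← measure_preimage_add volume a (C \ Set.Iio (a + b))]
    refine measure_mono fun x hx => ⟨h a ha x hx, ?_⟩
    have : b ≤ x := csInf_le hB.bddBelow hx
    simpa using this
  calc volume A + volume B ≤ _ := add_le_add h1 h2
    _ = volume C := measure_inter_add_sdiff C measurableSet_Iio

/-- The one-dimensional Brunn–Minkowski inequality, in midpoint form. -/
theorem Real.volume_add_volume_le {A B C : Set ℝ} (hA : MeasurableSet A)
    (hB : MeasurableSet B) (hAn : A.Nonempty) (hBn : B.Nonempty)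
    (h : ∀ a ∈ A, ∀ b ∈ B, (2⁻¹ : ℝ) • (a + b) ∈ C) :
    volume A + volume B ≤ 2 * volume C := by
  have hC : volume ((fun x : ℝ => (2⁻¹ : ℝ) * x) ⁻¹' C) = 2 * volume C := by
    rw [Real.volume_preimage_mul_left (by norm_num)]
    norm_num
  rw [← hC, hA.measure_eq_iSup_isCompact, hB.measure_eq_iSup_isCompact]
  obtain ⟨a, ha⟩ := hAn
  obtain ⟨b, hb⟩ := hBn
  simp only [iSup_and']
  have key : ∀ K L : Set ℝ, (K ⊆ A ∧ IsCompact K) → (L ⊆ B ∧ IsCompact L) →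
      volume K + volume L ≤ volume ((fun x : ℝ => (2⁻¹ : ℝ) * x) ⁻¹' C) := by
    rintro K L ⟨hKA, hK⟩ ⟨hLB, hL⟩
    calc volume K + volume L ≤ volume (insert a K) + volume (insert b L) := by
          gcongr <;> exact Set.subset_insert _ _
      _ ≤ _ := by
        refine Real.volume_add_volume_le_of_isCompact (hK.insert a) (hL.insert b)
          (Set.insert_nonempty _ _) (Set.insert_nonempty _ _) fun x hx y hy => h x ?_ y ?_
        · exact Set.insert_subset ha hKA hx
        · exact Set.insert_subset hb hLB hy
  refine ENNReal.biSup_add_biSup_le' (p := fun K => K ⊆ A ∧ IsCompact K)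
    (q := fun L => L ⊆ B ∧ IsCompact L) ⟨∅, by simp⟩ ⟨∅, by simp⟩ fun K hK L hL => key K L hK hL

theorem ENNReal.four_mul_mul_le_add_sq (x y : ℝ≥0∞) : 4 * (x * y) ≤ (x + y) ^ 2 := by
  by_cases hx : x = ∞
  · simp [hx]
  by_cases hy : y = ∞
  · simp [hy]
  lift x to NNReal using hx
  lift y to NNReal using hy
  norm_cast
  rw [← NNReal.coe_le_coe]
  push_cast
  nlinarith [sq_nonneg ((x : ℝ) - y)]

/-- A measure satisfies the midpoint Prékopa–Leindler inequality. -/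
def IsPrekopaLeindler {E : Type*} [AddCommGroup E] [Module ℝ E] [MeasurableSpace E]
    (μ : Measure E) : Prop :=
  ∀ f g h : E → ℝ≥0∞, Measurable f → Measurable g → Measurable h →
    (∀ x y, f x * g y ≤ h ((2⁻¹ : ℝ) • (x + y)) ^ 2) →
    (∫⁻ x, f x ∂μ) * (∫⁻ x, g x ∂μ) ≤ (∫⁻ x, h x ∂μ) ^ 2

theorem lintegral_add_lintegral_le_of_iSup_eq_one {f g h : ℝ → ℝ≥0∞} (hf : Measurable f)
    (hg : Measurable g) (hh : Measurable h) (hf1 : ⨆ x, f x = 1) (hg1 : ⨆ x, g x = 1)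
    (H : ∀ x y, f x * g y ≤ h ((2⁻¹ : ℝ) • (x + y)) ^ 2) :
    (∫⁻ x, f x) + (∫⁻ x, g x) ≤ 2 * ∫⁻ x, h x := by
  have hfle : ∀ x, f x ≤ 1 := fun x => hf1 ▸ le_iSup f x
  have hgle : ∀ x, g x ≤ 1 := fun x => hg1 ▸ le_iSup g x
  have layer : ∀ k : ℝ → ℝ≥0∞, Measurable k → (∀ x, k x ≤ 1) →
      ∫⁻ x, k x = ∫⁻ t in Set.Ioi (0 : ℝ), volume {x | ENNReal.ofReal t < k x} := by
    intro k hk hk1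
    have hfin : ∀ x, k x ≠ ∞ := fun x => ((hk1 x).trans_lt ENNReal.one_lt_top).ne
    have := lintegral_eq_lintegral_meas_lt (volume : Measure ℝ) (f := fun x => (k x).toReal)
      (Filter.Eventually.of_forall fun x => ENNReal.toReal_nonneg) hk.ennreal_toReal.aemeasurable
    simp only [ENNReal.ofReal_toReal (hfin _)] at this
    rw [this]
    refine setLIntegral_congr_fun measurableSet_Ioi fun t ht => ?_
    congr 1
    ext x
    exact (ENNReal.ofReal_lt_iff_lt_toReal (le_of_lt ht) (hfin x)).symm
  have hle : ∫⁻ x, min (h x) 1 ≤ ∫⁻ x, h x := lintegral_mono fun x => min_le_left _ _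
  refine le_trans ?_ (mul_le_mul_right hle 2)
  rw [layer f hf hfle, layer g hg hgle,
    layer (fun x => min (h x) 1) (hh.min measurable_const) (fun x => min_le_right _ _),
    ← lintegral_const_mul' _ _ (by simp)]
  refine (le_lintegral_add _ _).trans (setLIntegral_mono' measurableSet_Ioi fun t ht => ?_)
  rcases lt_or_ge t 1 with ht1 | ht1
  · have ht1' : ENNReal.ofReal t < 1 := by simpa using ht1
    refine Real.volume_add_volume_le (measurableSet_lt measurable_const hf)
      (measurableSet_lt measurable_const hg) ?_ ?_ ?_
    · exact lt_iSup_iff.1 (hf1 ▸ ht1')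
    · exact lt_iSup_iff.1 (hg1 ▸ ht1')
    · intro x hx y hy
      refine lt_min ?_ ht1'
      by_contra hcon
      rw [not_lt] at hcon
      have h1 : ENNReal.ofReal t * ENNReal.ofReal t < f x * g y := ENNReal.mul_lt_mul hx hy
      refine absurd (h1.trans_le (H x y)) (not_lt.2 ?_)
      rw [sq]
      exact mul_le_mul' hcon hcon
  · have ht1' : 1 ≤ ENNReal.ofReal t := by simpa using ht1
    have e1 : {x | ENNReal.ofReal t < f x} = ∅ :=
      Set.eq_empty_of_forall_notMem fun x hx => (not_lt.2 ((hfle x).trans ht1')) hx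
    have e2 : {x | ENNReal.ofReal t < g x} = ∅ :=
      Set.eq_empty_of_forall_notMem fun x hx => (not_lt.2 ((hgle x).trans ht1')) hx
    simp [e1, e2]

theorem lintegral_mul_lintegral_le_of_iSup_ne_top {f g h : ℝ → ℝ≥0∞} (hf : Measurable f)
    (hg : Measurable g) (hh : Measurable h) (hf1 : ⨆ x, f x ≠ ∞) (hg1 : ⨆ x, g x ≠ ∞)
    (H : ∀ x y, f x * g y ≤ h ((2⁻¹ : ℝ) • (x + y)) ^ 2) :
    (∫⁻ x, f x) * (∫⁻ x, g x) ≤ (∫⁻ x, h x) ^ 2 := by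
  set a := ⨆ x, f x with ha
  set b := ⨆ x, g x with hb
  rcases eq_or_ne a 0 with ha0 | ha0
  · have : ∀ x, f x = 0 := fun x => le_antisymm (ha0 ▸ le_iSup f x) zero_le
    simp [this]
  rcases eq_or_ne b 0 with hb0 | hb0
  · have : ∀ x, g x = 0 := fun x => le_antisymm (hb0 ▸ le_iSup g x) zero_le
    simp [this]
  obtain ⟨r, hr⟩ : ∃ r : ℝ≥0∞, r ^ 2 = a * b := by
    refine ⟨(a * b) ^ (1 / 2 : ℝ), ?_⟩
    rw [← ENNReal.rpow_natCast, ← ENNReal.rpow_mul]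
    norm_num
  have hab0 : a * b ≠ 0 := mul_ne_zero ha0 hb0
  have habt : a * b ≠ ∞ := ENNReal.mul_ne_top hf1 hg1
  have hr0 : r ≠ 0 := by rintro rfl; exact hab0 (by simpa using hr.symm)
  have hrt : r ≠ ∞ := by rintro rfl; exact habt (by simpa using hr.symm)
  have key := lintegral_add_lintegral_le_of_iSup_eq_one (f := fun x => f x * a⁻¹)
    (g := fun x => g x * b⁻¹) (h := fun x => h x * r⁻¹) (hf.mul_const _) (hg.mul_const _)
    (hh.mul_const _) (by rw [← ENNReal.iSup_mul, ENNReal.mul_inv_cancel ha0 hf1])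
    (by rw [← ENNReal.iSup_mul, ENNReal.mul_inv_cancel hb0 hg1]) (fun x y => by
      calc f x * a⁻¹ * (g y * b⁻¹) = f x * g y * (a * b)⁻¹ := by
            rw [ENNReal.mul_inv (Or.inl ha0) (Or.inl hf1)]; ring
        _ ≤ h ((2⁻¹ : ℝ) • (x + y)) ^ 2 * (a * b)⁻¹ := by gcongr; exact H x y
        _ = _ := by rw [← hr, mul_pow, ENNReal.inv_pow])
  rw [lintegral_mul_const _ hf, lintegral_mul_const _ hg, lintegral_mul_const _ hh] at key
  have h4 := (ENNReal.four_mul_mul_le_add_sq _ _).trans (pow_le_pow_left' key 2)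
  have h5 : 4 * ((∫⁻ x, f x) * (∫⁻ x, g x)) * (a * b)⁻¹ ≤
      4 * (∫⁻ x, h x) ^ 2 * (a * b)⁻¹ := by
    calc _ = 4 * ((∫⁻ x, f x) * a⁻¹ * ((∫⁻ x, g x) * b⁻¹)) := by
          rw [ENNReal.mul_inv (Or.inl ha0) (Or.inl hf1)]; ring
      _ ≤ _ := h4
      _ = _ := by rw [← hr, mul_pow, mul_pow, ENNReal.inv_pow]; ring
  rw [ENNReal.mul_le_mul_iff_left (ENNReal.inv_ne_zero.2 habt) (ENNReal.inv_ne_top.2 hab0),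
    ENNReal.mul_le_mul_iff_right (by simp) (by simp)] at h5
  exact h5

theorem isPrekopaLeindler_real : IsPrekopaLeindler (volume : Measure ℝ) := by
  intro f g h hf hg hh H
  have trunc : ∀ k : ℝ → ℝ≥0∞, Measurable k →
      ∫⁻ x, k x = ⨆ n : ℕ, ∫⁻ x, min (k x) n := by
    intro k hk
    rw [← lintegral_iSup (fun n => hk.min measurable_const)
      (fun m n hmn x => min_le_min_left _ (by exact_mod_cast hmn))]
    refine lintegral_congr fun x => ?_
    have := (inf_iSup_eq (k x) fun n : ℕ => (n : ℝ≥0∞)).symm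
    rw [ENNReal.iSup_natCast, inf_top_eq] at this
    exact this.symm
  rw [trunc f hf, trunc g hg, ENNReal.iSup_mul]
  refine iSup_le fun m => ?_
  rw [ENNReal.mul_iSup]
  refine iSup_le fun n => ?_
  refine lintegral_mul_lintegral_le_of_iSup_ne_top (hf.min measurable_const)
    (hg.min measurable_const) hh ?_ ?_ fun x y => ?_
  · exact ((iSup_le fun x => min_le_right _ _).trans_lt (ENNReal.natCast_lt_top m)).ne
  · exact ((iSup_le fun x => min_le_right _ _).trans_lt (ENNReal.natCast_lt_top n)).ne
  · exact (mul_le_mul' (min_le_left _ _) (min_le_left _ _)).trans (H x y)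

theorem IsPrekopaLeindler.prod {E F : Type*} [AddCommGroup E] [Module ℝ E] [MeasurableSpace E]
    [AddCommGroup F] [Module ℝ F] [MeasurableSpace F] {μ : Measure E} {ν : Measure F}
    [SFinite μ] [SFinite ν] (hμ : IsPrekopaLeindler μ) (hν : IsPrekopaLeindler ν) :
    IsPrekopaLeindler (μ.prod ν) := by
  intro f g h hf hg hh H
  rw [lintegral_prod _ hf.aemeasurable, lintegral_prod _ hg.aemeasurable,
    lintegral_prod _ hh.aemeasurable]
  exact hμ _ _ _ hf.lintegral_prod_right' hg.lintegral_prod_right' hh.lintegral_prod_right'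
    fun x y => hν _ _ _ (hf.comp measurable_prodMk_left) (hg.comp measurable_prodMk_left)
      (hh.comp measurable_prodMk_left) fun s t => H (x, s) (y, t)

theorem IsPrekopaLeindler.of_map {E F : Type*} [AddCommGroup E] [Module ℝ E] [MeasurableSpace E]
    [AddCommGroup F] [Module ℝ F] [MeasurableSpace F] {μ : Measure E} {ν : Measure F}
    (hμ : IsPrekopaLeindler μ) (e : E →ₗ[ℝ] F)
    (h : MeasurePreserving e μ ν) : IsPrekopaLeindler ν := by
  intro f g k hf hg hk H
  rw [← h.lintegral_comp hf, ← h.lintegral_comp hg, ← h.lintegral_comp hk]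
  exact hμ _ _ _ (hf.comp h.measurable) (hg.comp h.measurable) (hk.comp h.measurable)
    fun x y => by simpa using H (e x) (e y)

theorem IsPrekopaLeindler.smul {E : Type*} [AddCommGroup E] [Module ℝ E] [MeasurableSpace E]
    {μ : Measure E} (hμ : IsPrekopaLeindler μ) (c : ℝ≥0∞) : IsPrekopaLeindler (c • μ) := by
  intro f g h hf hg hh H
  simp only [lintegral_smul_measure, smul_eq_mul]
  calc _ = c ^ 2 * ((∫⁻ x, f x ∂μ) * ∫⁻ x, g x ∂μ) := by ring
    _ ≤ c ^ 2 * (∫⁻ x, h x ∂μ) ^ 2 := by gcongr; exact hμ f g h hf hg hh H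
    _ = _ := by ring

theorem isPrekopaLeindler_pi : ∀ n : ℕ, IsPrekopaLeindler (volume : Measure (Fin n → ℝ))
  | 0 => by
    intro f g h _ _ _ H
    have hv : (volume : Measure (Fin 0 → ℝ)) = Measure.dirac 0 := by
      rw [volume_pi, Measure.pi_of_empty _ 0]
    simpa [hv] using H 0 0
  | n + 1 => by
    refine (isPrekopaLeindler_real.prod (isPrekopaLeindler_pi n)).of_map
      (Fin.consLinearEquiv ℝ fun _ : Fin (n + 1) => ℝ).toLinearMap ?_
    convert! (volume_preserving_piFinSuccAbove (fun _ : Fin (n + 1) => ℝ) 0).symm using 1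
    ext1 x
    simp [Fin.consLinearEquiv, MeasurableEquiv.piFinSuccAbove]

/-- The Prékopa–Leindler inequality for Haar measures on finite-dimensional real spaces. -/
theorem isPrekopaLeindler_of_isAddHaarMeasure {E : Type*} [NormedAddCommGroup E]
    [NormedSpace ℝ E] [FiniteDimensional ℝ E] [MeasurableSpace E] [BorelSpace E]
    (μ : Measure E) [μ.IsAddHaarMeasure] : IsPrekopaLeindler μ := by
  let e : (Fin (Module.finrank ℝ E) → ℝ) ≃L[ℝ] E := (Module.finBasis ℝ E).equivFunL.symm
  have hmap : (volume.map e).IsAddHaarMeasure := e.isAddHaarMeasure_map volume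
  have hPL : IsPrekopaLeindler (volume.map e) :=
    (isPrekopaLeindler_pi _).of_map e.toLinearEquiv.toLinearMap
      (e.continuous.measurable.measurePreserving _)
  rw [Measure.isAddLeftInvariant_eq_smul μ (volume.map e)]
  exact hPL.smul _

theorem IsPrekopaLeindler.setIntegral_mul_setIntegral_le {E : Type*} [NormedAddCommGroup E]
    [NormedSpace ℝ E] [MeasurableSpace E] [BorelSpace E] {μ : Measure E}
    [IsFiniteMeasureOnCompacts μ] (hμ : IsPrekopaLeindler μ) {A B C : Set E} (hA : IsCompact A)
    (hB : IsCompact B) (hC : IsCompact C) {f g h : E → ℝ} (hf : Continuous f)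
    (hg : Continuous g) (hh : Continuous h) (hf0 : ∀ x ∈ A, 0 ≤ f x) (hg0 : ∀ x ∈ B, 0 ≤ g x)
    (hh0 : ∀ x ∈ C, 0 ≤ h x) (hABC : ∀ x ∈ A, ∀ y ∈ B, (2⁻¹ : ℝ) • (x + y) ∈ C)
    (H : ∀ x ∈ A, ∀ y ∈ B, f x * g y ≤ h ((2⁻¹ : ℝ) • (x + y)) ^ 2) :
    (∫ x in A, f x ∂μ) * (∫ x in B, g x ∂μ) ≤ (∫ x in C, h x ∂μ) ^ 2 := by
  have conv : ∀ (S : Set E) (k : E → ℝ), IsCompact S → Continuous k → (∀ x ∈ S, 0 ≤ k x) →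
      ENNReal.ofReal (∫ x in S, k x ∂μ) =
        ∫⁻ x, S.indicator (fun x => ENNReal.ofReal (k x)) x ∂μ := by
    intro S k hS hk hk0
    rw [ofReal_integral_eq_lintegral_ofReal (hk.continuousOn.integrableOn_compact hS)
      ((ae_restrict_iff' hS.measurableSet).2 (Filter.Eventually.of_forall hk0)),
      lintegral_indicator hS.measurableSet]
  have nonneg : ∀ (S : Set E) (k : E → ℝ), IsCompact S → (∀ x ∈ S, 0 ≤ k x) →
      0 ≤ ∫ x in S, k x ∂μ := fun S k hS hk0 => setIntegral_nonneg hS.measurableSet hk0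
  rw [← ENNReal.ofReal_le_ofReal_iff (sq_nonneg _), ENNReal.ofReal_mul (nonneg A f hA hf0),
    ENNReal.ofReal_pow (nonneg C h hC hh0), conv A f hA hf hf0, conv B g hB hg hg0,
    conv C h hC hh hh0]
  refine hμ _ _ _ (hf.measurable.ennreal_ofReal.indicator hA.measurableSet)
    (hg.measurable.ennreal_ofReal.indicator hB.measurableSet)
    (hh.measurable.ennreal_ofReal.indicator hC.measurableSet) fun x y => ?_
  by_cases hx : x ∈ A
  · by_cases hy : y ∈ B
    · rw [Set.indicator_of_mem hx, Set.indicator_of_mem hy, Set.indicator_of_mem (hABC x hx y hy),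
        ← ENNReal.ofReal_mul (hf0 x hx), ← ENNReal.ofReal_pow (hh0 _ (hABC x hx y hy))]
      exact ENNReal.ofReal_le_ofReal (H x hx y hy)
    · simp [hy]
  · simp [hx]

theorem tilt_mul_tilt_le {ε a b t η : ℝ} (ha : |ε * a| ≤ 1 / 4) (hb : |ε * b| ≤ 1 / 4)
    (hη : 0 ≤ η) (ht0 : 0 ≤ t) (ht : t ^ 2 ≤ (a - b) ^ 2) :
    (1 + ε * a) * (1 + ε ^ 2 * η * t) * ((1 + ε * b) * (1 - 2 * ε ^ 2 * η ^ 2)) ≤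
      (1 + ε * (2⁻¹ * (a + b))) ^ 2 := by
  rw [abs_le] at ha hb
  set P := (1 + ε * a) * (1 + ε * b) with hP
  have hP0 : 0 ≤ P := mul_nonneg (by linarith) (by linarith)
  have hP2 : P ≤ 2 := by nlinarith
  have e2 : (1 + ε ^ 2 * η * t) * (1 - 2 * ε ^ 2 * η ^ 2) ≤ 1 + ε ^ 2 * (a - b) ^ 2 / 8 := by
    have q1 : 0 ≤ ε ^ 2 * (t - 4 * η) ^ 2 := by positivity
    have q2 : 0 ≤ ε ^ 2 * ((a - b) ^ 2 - t ^ 2) := mul_nonneg (sq_nonneg _) (by linarith)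
    have q3 : 0 ≤ (ε ^ 2 * η * t) * (ε ^ 2 * η ^ 2) := by positivity
    linear_combination q1 / 8 + q2 / 8 + 2 * q3
  calc _ = P * ((1 + ε ^ 2 * η * t) * (1 - 2 * ε ^ 2 * η ^ 2)) := by rw [hP]; ring
    _ ≤ P * (1 + ε ^ 2 * (a - b) ^ 2 / 8) := by gcongr
    _ = P + P * (ε ^ 2 * (a - b) ^ 2 / 8) := by ring
    _ ≤ P + 2 * (ε ^ 2 * (a - b) ^ 2 / 8) := by gcongr
    _ = _ := by rw [hP]; ring

theorem lt_tilt_mul {Q m η ε X : ℝ} (hQ : 0 < Q) (hη : 0 < η) (hε : ε ≠ 0)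
    (hm : m = 8 * Q * η) (hεη : ε ^ 2 * η ^ 2 < 1 / 4) (hX : m / 2 ≤ X) :
    Q < (Q + ε ^ 2 * η * X) * (1 - 2 * ε ^ 2 * η ^ 2) := by
  have h1 : (Q + ε ^ 2 * η * (m / 2)) * (1 - 2 * ε ^ 2 * η ^ 2) ≤
      (Q + ε ^ 2 * η * X) * (1 - 2 * ε ^ 2 * η ^ 2) := by
    gcongr
    linarith
  refine lt_of_lt_of_le ?_ h1
  have h2 : 0 < (8 * Q * η ^ 2 * ε ^ 2) * (1 / 4 - ε ^ 2 * η ^ 2) :=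
    mul_pos (by positivity) (by linarith)
  rw [hm]
  linear_combination h2

theorem IsPrekopaLeindler.setIntegral_max_sub_nonpos {E : Type*} [NormedAddCommGroup E]
    [NormedSpace ℝ E] [MeasurableSpace E] [BorelSpace E] {μ : Measure E}
    [IsFiniteMeasureOnCompacts μ] (hμ : IsPrekopaLeindler μ) {A B C : Set E} (hA : IsCompact A)
    (hB : IsCompact B) (hC : IsCompact C)
    (hABC : ∀ x ∈ A, ∀ y ∈ B, (2⁻¹ : ℝ) • (x + y) ∈ C) {Q : ℝ} (hQ : 0 < Q)
    (hAQ : μ.real A = Q) (hBQ : μ.real B = Q) (hCQ : μ.real C ≤ Q) (s : E →L[ℝ] ℝ)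
    (hsA : ∫ x in A, s x ∂μ = 0) (hsB : ∫ x in B, s x ∂μ = 0) {c : ℝ}
    (hBc : ∀ x ∈ B, s x ≤ c) : ∫ x in A, max (s x - c) 0 ∂μ ≤ 0 := by
  by_contra! hm
  set m := ∫ x in A, max (s x - c) 0 ∂μ with hmdef
  set N := ∫ x in A, s x * max (s x - c) 0 ∂μ with hNdef
  obtain ⟨R, hR⟩ : ∃ R, ∀ x ∈ A ∪ B ∪ C, |s x| ≤ R := by
    obtain ⟨R, hR⟩ := ((hA.union hB).union hC).exists_bound_of_continuousOn
      s.continuous.continuousOn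
    exact ⟨R, hR⟩
  set η := m / (8 * Q) with hη
  have hη0 : 0 < η := by positivity
  obtain ⟨e, he0, he1, he2, he3⟩ : ∃ e : ℝ, 0 < e ∧ e * R < 1 / 4 ∧ e * |N| < m / 2 ∧
      e * η < 1 / 2 := by
    have h1 : ∀ a b : ℝ, 0 < b → ∀ᶠ e in nhdsWithin (0 : ℝ) (Set.Ioi 0), e * a < b := by
      intro a b hb
      have : Filter.Tendsto (fun e : ℝ => e * a) (nhdsWithin 0 (Set.Ioi 0)) (nhds (0 * a)) :=
        ((continuous_id.mul continuous_const).tendsto 0).mono_left nhdsWithin_le_nhds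
      exact this.eventually_lt_const (by simpa using hb)
    obtain ⟨e, h⟩ := ((eventually_mem_nhdsWithin).and ((h1 R (1 / 4) (by norm_num)).and
      ((h1 |N| (m / 2) (by positivity)).and (h1 η (1 / 2) (by norm_num))))).exists
    exact ⟨e, h⟩
  obtain ⟨ε, hεe, hεC⟩ : ∃ ε : ℝ, |ε| = e ∧ ε * ∫ x in C, s x ∂μ ≤ 0 := by
    rcases le_total (∫ x in C, s x ∂μ) 0 with h | h
    · exact ⟨e, abs_of_pos he0, mul_nonpos_of_nonneg_of_nonpos he0.le h⟩
    · exact ⟨-e, by rw [abs_neg, abs_of_pos he0], by nlinarith⟩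
  have hεs : ∀ x ∈ A ∪ B ∪ C, |ε * s x| ≤ 1 / 4 := by
    intro x hx
    rw [abs_mul, hεe]
    nlinarith [hR x hx]
  have hε2 : ε ^ 2 = e ^ 2 := by rw [← hεe, sq_abs]
  have hεη : ε ^ 2 * η ^ 2 < 1 / 4 := by
    rw [hε2]
    have : 0 < e * η := by positivity
    nlinarith
  have hεN : |ε * N| ≤ m / 2 := by rw [abs_mul, hεe]; exact he2.le
  have hsc := s.continuous
  have key := hμ.setIntegral_mul_setIntegral_le hA hB hC
    (f := fun x => (1 + ε * s x) * (1 + ε ^ 2 * η * max (s x - c) 0))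
    (g := fun x => (1 + ε * s x) * (1 - 2 * ε ^ 2 * η ^ 2)) (h := fun x => 1 + ε * s x)
    (by fun_prop) (by fun_prop) (by fun_prop)
    (fun x hx => by
      have := abs_le.1 (hεs x (Or.inl (Or.inl hx)))
      have h2 := le_max_right (s x - c) 0
      exact mul_nonneg (by linarith) (by positivity))
    (fun x hx => by
      have := abs_le.1 (hεs x (Or.inl (Or.inr hx)))
      exact mul_nonneg (by linarith) (by linarith))
    (fun x hx => by
      have := abs_le.1 (hεs x (Or.inr hx))
      linarith)
    hABC
    (fun x hx y hy => by
      have h1 := abs_le.1 (hεs x (Or.inl (Or.inl hx)))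
      have h2 := abs_le.1 (hεs y (Or.inl (Or.inr hy)))
      have hyc := hBc y hy
      simp only [map_smul, map_add, smul_eq_mul]
      refine tilt_mul_tilt_le (abs_le.2 h1) (abs_le.2 h2) hη0.le (le_max_right _ _) ?_
      rcases le_total (s x - c) 0 with h | h
      · rw [max_eq_right h]; nlinarith [sq_nonneg (s x - s y)]
      · rw [max_eq_left h]; nlinarith)
  have int : ∀ (S : Set E) (k : E → ℝ), IsCompact S → Continuous k → IntegrableOn k S μ :=
    fun S k hS hk => hk.continuousOn.integrableOn_compact hS
  have iA : ∫ x in A, (1 + ε * s x) * (1 + ε ^ 2 * η * max (s x - c) 0) ∂μ =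
      Q + ε ^ 2 * η * (m + ε * N) := by
    have : ∀ x, (1 + ε * s x) * (1 + ε ^ 2 * η * max (s x - c) 0) = 1 + ε * s x +
        (ε ^ 2 * η * max (s x - c) 0 + ε ^ 3 * η * (s x * max (s x - c) 0)) :=
      fun x => by ring
    simp only [this]
    rw [integral_add (int A _ hA (by fun_prop)) (int A _ hA (by fun_prop)),
      integral_add (int A _ hA (by fun_prop)) (int A _ hA (by fun_prop)),
      integral_add (int A _ hA (by fun_prop)) (int A _ hA (by fun_prop)),
      integral_const_mul, integral_const_mul, integral_const_mul, hsA, setIntegral_const, hAQ,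
      ← hmdef, ← hNdef]
    simp only [smul_eq_mul]
    ring
  have iS : ∀ S, IsCompact S → ∫ x in S, (1 + ε * s x) ∂μ = μ.real S + ε * ∫ x in S, s x ∂μ := by
    intro S hS
    rw [integral_add (int S _ hS (by fun_prop)) (int S _ hS (by fun_prop)),
      integral_const_mul, setIntegral_const]
    simp
  have iCnonneg : 0 ≤ ∫ x in C, (1 + ε * s x) ∂μ :=
    setIntegral_nonneg hC.measurableSet fun x hx => by
      have := abs_le.1 (hεs x (Or.inr hx))
      linarith
  have iC : ∫ x in C, (1 + ε * s x) ∂μ ≤ Q := by rw [iS C hC]; linarith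
  rw [iA, integral_mul_const, iS B hB, hBQ, hsB, mul_zero, add_zero] at key
  have key2 := key.trans (pow_le_pow_left₀ iCnonneg iC 2)
  have hlt := lt_tilt_mul hQ hη0 (abs_pos.1 (hεe ▸ he0)) (by rw [hη]; field_simp) hεη
    (by have := (abs_le.1 hεN).1; linarith : m / 2 ≤ m + ε * N)
  nlinarith

theorem Convex.measure_inter_pos {E : Type*} [NormedAddCommGroup E] [NormedSpace ℝ E]
    [FiniteDimensional ℝ E] [MeasurableSpace E] [BorelSpace E] (μ : Measure E)
    [μ.IsAddHaarMeasure] {A U : Set E} (hAc : IsClosed A) (hA : Convex ℝ A) (hA0 : μ A ≠ 0)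
    (hU : IsOpen U) (h : (A ∩ U).Nonempty) : 0 < μ (A ∩ U) := by
  have hint : (interior A).Nonempty := by
    by_contra hcon
    rw [Set.not_nonempty_iff_eq_empty] at hcon
    have := hA.addHaar_frontier μ
    rw [hAc.frontier_eq, hcon, Set.sdiff_empty] at this
    exact hA0 this
  obtain ⟨x, hxA, hxU⟩ := h
  have hx : x ∈ closure (interior A) := by
    rw [hA.closure_interior_eq_closure_of_nonempty_interior hint]
    exact subset_closure hxA
  obtain ⟨y, hy⟩ := mem_closure_iff.1 hx U hU hxU
  exact ((hU.inter isOpen_interior).measure_pos μ ⟨y, hy⟩).trans_le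
    (measure_mono fun z hz => ⟨interior_subset hz.2, hz.1⟩)

/-- A convex compact set of positive measure equals any closed subset of the same measure. -/
theorem Convex.eq_of_subset_of_measure_le {E : Type*} [NormedAddCommGroup E] [NormedSpace ℝ E]
    [FiniteDimensional ℝ E] [MeasurableSpace E] [BorelSpace E] (μ : Measure E)
    [μ.IsAddHaarMeasure] {A B : Set E} (hAc : IsCompact A) (hA : Convex ℝ A) (hA0 : μ A ≠ 0)
    (hB : IsClosed B) (hBA : B ⊆ A) (h : μ A ≤ μ B) : A = B := by
  refine Set.Subset.antisymm (fun x hx => ?_) hBA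
  by_contra hxB
  have hpos := Convex.measure_inter_pos μ hAc.isClosed hA hA0 hB.isOpen_compl ⟨x, hx, hxB⟩
  have hfin : μ B ≠ ⊤ := ((measure_mono hBA).trans_lt hAc.measure_lt_top).ne
  rw [← Set.sdiff_eq, measure_sdiff hBA hB.measurableSet.nullMeasurableSet hfin,
    tsub_eq_zero_of_le h] at hpos
  exact lt_irrefl _ hpos

section EqualityCase

variable {E : Type*} [NormedAddCommGroup E] [NormedSpace ℝ E] [FiniteDimensional ℝ E]
  [MeasurableSpace E] [BorelSpace E] (μ : Measure E) [μ.IsAddHaarMeasure]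

theorem subset_of_measure_midpoint_le {A B C : Set E} (hA : IsCompact A) (hB : IsCompact B)
    (hC : IsCompact C) (hAcv : Convex ℝ A) (hBcv : Convex ℝ B)
    (hABC : ∀ x ∈ A, ∀ y ∈ B, (2⁻¹ : ℝ) • (x + y) ∈ C) {Q : ℝ} (hQ : 0 < Q)
    (hAQ : μ.real A = Q) (hBQ : μ.real B = Q) (hCQ : μ.real C ≤ Q)
    (hA0 : ∫ x in A, x ∂μ = 0) (hB0 : ∫ x in B, x ∂μ = 0) : A ⊆ B := by
  intro x hx
  by_contra hxB
  obtain ⟨s, c, hBc, hxc⟩ := geometric_hahn_banach_closed_point hBcv hB.isClosed hxB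
  have hs : ∀ S : Set E, IsCompact S → ∫ x in S, x ∂μ = 0 → ∫ x in S, s x ∂μ = 0 := by
    intro S hS h
    have hi : IntegrableOn (fun x : E => x) S μ := continuous_id.continuousOn.integrableOn_compact hS
    rw [s.integral_comp_comm hi, h, map_zero]
  have hle := (isPrekopaLeindler_of_isAddHaarMeasure μ).setIntegral_max_sub_nonpos hA hB hC hABC hQ
    hAQ hBQ hCQ s (hs A hA hA0) (hs B hB hB0) fun y hy => (hBc y hy).le
  have hsc := s.continuous
  have hpos : 0 < μ (A ∩ {y | c < s y}) :=
    Convex.measure_inter_pos μ hA.isClosed hAcv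
      (fun h => by simp [Measure.real, h] at hAQ; exact hQ.ne hAQ)
      (isOpen_lt continuous_const hsc) ⟨x, hx, hxc⟩
  refine absurd hle (not_le.2 ?_)
  rw [setIntegral_pos_iff_support_of_nonneg_ae (f := fun y => max (s y - c) 0)
    (Filter.Eventually.of_forall fun y => le_max_right _ _)
    ((by fun_prop : Continuous fun y => max (s y - c) 0).continuousOn.integrableOn_compact hA)]
  refine hpos.trans_le (measure_mono fun y hy => ⟨?_, hy.1⟩)
  have : c < s y := hy.2
  simpa using this

/-- The equality case of the Brunn–Minkowski inequality for compact convex sets of equal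
volume: if the midpoints of `A` and `B` fill no more volume than `A` and `B` do, then `B` is a
translate of `A`. -/
theorem exists_vadd_eq_of_measure_midpoint_le {A B C : Set E} (hA : IsCompact A)
    (hB : IsCompact B) (hC : IsCompact C) (hAcv : Convex ℝ A) (hBcv : Convex ℝ B)
    (hABC : ∀ x ∈ A, ∀ y ∈ B, (2⁻¹ : ℝ) • (x + y) ∈ C) {Q : ℝ} (hQ : 0 < Q)
    (hAQ : μ.real A = Q) (hBQ : μ.real B = Q) (hCQ : μ.real C ≤ Q) :
    ∃ w : E, B = w +ᵥ A := by
  have centered : ∀ S : Set E, IsCompact S → μ.real S = Q →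
      ∃ z : E, ∫ x in z +ᵥ S, x ∂μ = 0 := by
    intro S hS hSQ
    refine ⟨-(Q⁻¹ • ∫ x in S, x ∂μ), ?_⟩
    set z := -(Q⁻¹ • ∫ x in S, x ∂μ) with hz
    have hi : IntegrableOn (fun x : E => x) S μ := continuous_id.continuousOn.integrableOn_compact hS
    rw [← Set.image_vadd]
    have := (measurePreserving_add_left μ z).setIntegral_image_emb
      (measurableEmbedding_addLeft z) (fun x => x) S
    simp only [vadd_eq_add]
    rw [this, integral_add (continuousOn_const.integrableOn_compact hS) hi, setIntegral_const, hSQ, hz,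
      smul_neg, smul_inv_smul₀ hQ.ne']
    simp
  obtain ⟨a, ha⟩ := centered A hA hAQ
  obtain ⟨b, hb⟩ := centered B hB hBQ
  have real_vadd : ∀ (z : E) (S : Set E), μ.real (z +ᵥ S) = μ.real S := fun z S => by
    simp [Measure.real, measure_vadd]
  have hmid : ∀ x ∈ a +ᵥ A, ∀ y ∈ b +ᵥ B, (2⁻¹ : ℝ) • (x + y) ∈ ((2⁻¹ : ℝ) • (a + b)) +ᵥ C := by
    rintro _ ⟨x, hx, rfl⟩ _ ⟨y, hy, rfl⟩
    refine ⟨_, hABC x hx y hy, ?_⟩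
    simp only [vadd_eq_add]
    module
  have h1 := subset_of_measure_midpoint_le μ (hA.vadd a) (hB.vadd b)
    (hC.vadd ((2⁻¹ : ℝ) • (a + b))) (hAcv.vadd a) (hBcv.vadd b) hmid hQ
    ((real_vadd _ _).trans hAQ) ((real_vadd _ _).trans hBQ) ((real_vadd _ _).trans_le hCQ) ha hb
  have h2 := subset_of_measure_midpoint_le μ (hB.vadd b) (hA.vadd a)
    (hC.vadd ((2⁻¹ : ℝ) • (a + b))) (hBcv.vadd b) (hAcv.vadd a)
    (fun x hx y hy => by rw [add_comm x y]; exact hmid y hy x hx) hQ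
    ((real_vadd _ _).trans hBQ) ((real_vadd _ _).trans hAQ) ((real_vadd _ _).trans_le hCQ) hb ha
  refine ⟨-b + a, ?_⟩
  rw [add_vadd, h1.antisymm h2, neg_vadd_vadd]

theorem mem_of_forall_combo_mem {E : Type*} [NormedAddCommGroup E] [NormedSpace ℝ E] {A : Set E}
    (hA : IsCompact A) (hAn : A.Nonempty) {t : ℝ} (ht0 : 0 < t) (ht1 : t ≤ 1) {y : E}
    (h : ∀ z ∈ A, (1 - t) • z + t • y ∈ A) : y ∈ A := by
  obtain ⟨z, hz, hzd⟩ := hA.exists_infDist_eq_dist hAn y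
  have h1 := Metric.infDist_le_dist_of_mem (x := y) (h z hz)
  have h2 : dist y ((1 - t) • z + t • y) = (1 - t) * dist y z := by
    rw [dist_eq_norm, dist_eq_norm, ← abs_of_nonneg (sub_nonneg.2 ht1), ← Real.norm_eq_abs,
      ← norm_smul]
    congr 1
    rw [Real.norm_eq_abs, abs_of_nonneg (sub_nonneg.2 ht1)]
    module
  rw [hzd, h2] at h1
  have h3 : dist y z = 0 := le_antisymm (by nlinarith) dist_nonneg
  rwa [dist_eq_zero.1 h3]

/-- A compact convex family of sections, all of volume at most `Q`, whose sections at `a` and `b`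
have volume `Q`, is a prism between `a` and `b`, and is contained in the infinite cylinder spanned
by this prism. -/
theorem exists_prism_of_measure_le {D : ℝ → Set E} (hDc : ∀ p, IsCompact (D p))
    (hD : ∀ p q t : ℝ, 0 ≤ t → t ≤ 1 → ∀ y ∈ D p, ∀ z ∈ D q,
      (1 - t) • y + t • z ∈ D ((1 - t) * p + t * q)) {Q : ℝ} (hQ : 0 < Q)
    (hle : ∀ p, μ.real (D p) ≤ Q) {a b : ℝ} (hab : a < b) (ha : μ.real (D a) = Q)
    (hb : μ.real (D b) = Q) :
    ∃ w : E, (∀ p ∈ Set.Icc a b, D p = ((p - a) / (b - a)) • w +ᵥ D a) ∧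
      ∀ p, ∀ y ∈ D p, y - ((p - a) / (b - a)) • w ∈ D a := by
  have hcv : ∀ p, Convex ℝ (D p) := by
    intro p y hy z hz r t hr ht hrt
    obtain rfl : r = 1 - t := by linarith
    convert hD p p t ht (by linarith) y hy z hz using 2
    ring
  obtain ⟨w, hw⟩ := exists_vadd_eq_of_measure_midpoint_le μ (hDc a) (hDc b)
    (hDc ((1 - 2⁻¹) * a + 2⁻¹ * b)) (hcv a) (hcv b) (fun x hx y hy => by
      convert hD a b 2⁻¹ (by norm_num) (by norm_num) x hx y hy using 1
      module) hQ ha hb (hle _)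
  have hba : 0 < b - a := sub_pos.2 hab
  have hmem : ∀ y ∈ D a, y + w ∈ D b := fun y hy => by
    rw [hw, add_comm]; exact Set.vadd_mem_vadd_set hy
  have hmem' : ∀ y ∈ D b, y - w ∈ D a := fun y hy => by
    rw [hw] at hy
    obtain ⟨z, hz, rfl⟩ := hy
    simpa using hz
  have hne : (D a).Nonempty := by
    rw [Set.nonempty_iff_ne_empty]
    intro h
    simp [h] at ha
    exact hQ.ne ha
  have hmid : ∀ p ∈ Set.Icc a b, D p = ((p - a) / (b - a)) • w +ᵥ D a := by
    intro p hp
    set t := (p - a) / (b - a) with ht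
    have ht0 : 0 ≤ t := div_nonneg (sub_nonneg.2 hp.1) hba.le
    have ht1 : t ≤ 1 := (div_le_one hba).2 (by linarith [hp.2])
    have hpt : (1 - t) * a + t * b = p := by rw [ht]; field_simp; ring
    have hsub : t • w +ᵥ D a ⊆ D p := by
      rintro _ ⟨y, hy, rfl⟩
      have := hD a b t ht0 ht1 y hy (y + w) (hmem y hy)
      rw [hpt] at this
      convert this using 1
      simp only [vadd_eq_add]
      module
    have hvol : μ (D p) ≤ μ (t • w +ᵥ D a) := by
      rw [measure_vadd, ← ENNReal.toReal_le_toReal (hDc p).measure_lt_top.ne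
        (hDc a).measure_lt_top.ne]
      exact (hle p).trans ha.ge
    refine Convex.eq_of_subset_of_measure_le μ (hDc p) (hcv p) (fun h0 => ?_)
      ((hDc a).vadd _).isClosed hsub hvol
    have := measure_mono_null hsub h0
    rw [measure_vadd] at this
    simp [Measure.real, this] at ha
    exact hQ.ne ha
  refine ⟨w, hmid, fun p y hy => ?_⟩
  rcases lt_or_ge p a with hpa | hpa
  · have hbp : 0 < b - p := by linarith
    set t := (b - a) / (b - p) with ht
    have ht0 : 0 < t := div_pos hba hbp
    have ht1 : t ≤ 1 := (div_le_one hbp).2 (by linarith)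
    refine mem_of_forall_combo_mem (hDc a) hne ht0 ht1 fun z hz => ?_
    have := hD b p t ht0.le ht1 (z + w) (hmem z hz) y hy
    have hpt : (1 - t) * b + t * p = a := by rw [ht]; field_simp; ring
    rw [hpt] at this
    have htt : t * ((p - a) / (b - a)) = -(1 - t) := by rw [ht]; field_simp; ring
    convert this using 1
    rw [smul_sub, smul_smul, htt]
    module
  rcases le_or_gt p b with hpb | hpb
  · rw [hmid p ⟨hpa, hpb⟩] at hy
    obtain ⟨z, hz, rfl⟩ := hy
    simpa using hz
  · have hap : 0 < p - a := by linarith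
    set t := (b - a) / (p - a) with ht
    have ht0 : 0 < t := div_pos hba hap
    have ht1 : t ≤ 1 := (div_le_one hap).2 (by linarith)
    refine mem_of_forall_combo_mem (hDc a) hne ht0 ht1 fun z hz => ?_
    have := hD a p t ht0.le ht1 z hz y hy
    have hpt : (1 - t) * a + t * p = b := by rw [ht]; field_simp; ring
    rw [hpt] at this
    have htt : t * ((p - a) / (b - a)) = 1 := by rw [ht]; field_simp
    convert hmem' _ this using 1
    rw [smul_sub, smul_smul, htt]
    module

/-- The section volumes of a compact set are upper semicontinuous. -/
theorem isClosed_setOf_le_measureReal_section {T : Set (ℝ × E)} (hT : IsCompact T) (Q : ℝ) :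
    IsClosed {p : ℝ | Q ≤ μ.real {y | (p, y) ∈ T}} := by
  have hfib : ∀ p, IsCompact {y | (p, y) ∈ T} := fun p =>
    (hT.image continuous_snd).of_isClosed_subset
      (hT.isClosed.preimage (Continuous.prodMk_right p)) fun y hy => ⟨(p, y), hy, rfl⟩
  rw [← isOpen_compl_iff, isOpen_iff_mem_nhds]
  intro p hp
  have hp' : μ.real {y | (p, y) ∈ T} < Q := not_le.1 hp
  have hlt : μ {y | (p, y) ∈ T} < ENNReal.ofReal Q :=
    (ENNReal.lt_ofReal_iff_toReal_lt (hfib p).measure_lt_top.ne).2 hp'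
  obtain ⟨U, hTU, hU, hUQ⟩ := Set.exists_isOpen_lt_of_lt _ _ hlt
  have hZ : IsCompact (Prod.fst '' (T ∩ Prod.snd ⁻¹' Uᶜ)) :=
    (hT.inter_right (hU.isClosed_compl.preimage continuous_snd)).image continuous_fst
  refine Filter.mem_of_superset (hZ.isClosed.isOpen_compl.mem_nhds ?_) fun q hq => ?_
  · rintro ⟨⟨_, y⟩, ⟨hy, hyU⟩, rfl⟩
    exact hyU (hTU hy)
  · refine not_le.2 ((ENNReal.lt_ofReal_iff_toReal_lt (hfib q).measure_lt_top.ne).1 ?_)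
    refine (measure_mono fun y hy => ?_).trans_lt hUQ
    by_contra hyU
    exact hq ⟨(q, y), ⟨hy, hyU⟩, rfl⟩

end EqualityCase

section Sections

variable {E : Type*} [NormedAddCommGroup E] [InnerProductSpace ℝ E] {u : E}

theorem inner_smul_add_orthogonal (hu : ‖u‖ = 1) (p : ℝ) (y : (ℝ ∙ u)ᗮ) :
    ⟪p • u + (y : E), u⟫ = p := by
  have := Submodule.mem_orthogonal_singleton_iff_inner_left.1 y.2
  rw [inner_add_left, this, real_inner_smul_left, real_inner_self_eq_norm_sq, hu]
  ring

theorem exists_eq_inner_smul_add (hu : ‖u‖ = 1) (x : E) :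
    ∃ y : (ℝ ∙ u)ᗮ, x = ⟪x, u⟫ • u + (y : E) := by
  refine ⟨⟨x - ⟪x, u⟫ • u, ?_⟩, by simp⟩
  rw [Submodule.mem_orthogonal_singleton_iff_inner_left, inner_sub_left, real_inner_smul_left,
    real_inner_self_eq_norm_sq, hu]
  ring

theorem inter_inner_eq_image (hu : ‖u‖ = 1) (K : Set E) (p : ℝ) :
    K ∩ {x | ⟪x, u⟫ = p} =
      (fun y : (ℝ ∙ u)ᗮ => p • u + (y : E)) '' {y | p • u + (y : E) ∈ K} := by
  ext x
  constructor
  · rintro ⟨hx, rfl⟩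
    obtain ⟨y, hy⟩ := exists_eq_inner_smul_add hu x
    exact ⟨y, by rwa [Set.mem_ofPred_eq, ← hy], hy.symm⟩
  · rintro ⟨y, hy, rfl⟩
    exact ⟨hy, inner_smul_add_orthogonal hu p y⟩

theorem isCompact_setOf_smul_add_mem (hu : ‖u‖ = 1) {K : Set E} (hK : IsCompact K) :
    IsCompact {z : ℝ × (ℝ ∙ u)ᗮ | z.1 • u + (z.2 : E) ∈ K} := by
  have hcont : Continuous fun x : E => (⟪x, u⟫, (ℝ ∙ u)ᗮ.orthogonalProjectionOnto x) := by fun_prop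
  refine (hK.image hcont).of_isClosed_subset (hK.isClosed.preimage (by fun_prop)) ?_
  rintro ⟨p, y⟩ hy
  refine ⟨_, hy, ?_⟩
  refine Prod.ext (inner_smul_add_orthogonal hu p y) ?_
  have h0 : (ℝ ∙ u)ᗮ.orthogonalProjectionOnto u = 0 :=
    Submodule.orthogonalProjectionOnto_orthogonal_apply_eq_zero (Submodule.mem_span_singleton_self u)
  simp [h0]

end Sections

theorem sectionVol_eq_measureReal {d : ℕ} {u : EuclideanSpace ℝ (Fin d)}
    (hu : ‖u‖ = 1) (K : Set (EuclideanSpace ℝ (Fin d))) (p : ℝ) :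
    sectionVol d K u p = (μH[Module.finrank ℝ (ℝ ∙ u)ᗮ] : Measure (ℝ ∙ u)ᗮ).real
      {y | p • u + (y : EuclideanSpace ℝ (Fin d)) ∈ K} := by
  have hrank : ((Module.finrank ℝ (ℝ ∙ u)ᗮ : ℕ) : ℝ) = (d : ℝ) - 1 := by
    have h := (ℝ ∙ u).finrank_add_finrank_orthogonal
    rw [finrank_span_singleton (norm_ne_zero_iff.1 (by rw [hu]; exact one_ne_zero)),
      finrank_euclideanSpace_fin] at h
    have h' : (1 : ℝ) + (Module.finrank ℝ (ℝ ∙ u)ᗮ : ℕ) = d := by exact_mod_cast h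
    linarith
  have hiso : Isometry fun y : (ℝ ∙ u)ᗮ => p • u + (y : EuclideanSpace ℝ (Fin d)) :=
    (IsometryEquiv.addLeft (p • u)).isometry.comp isometry_subtype_coe
  rw [sectionVol, inter_inner_eq_image hu, ← hrank,
    hiso.hausdorffMeasure_image (Or.inl (Nat.cast_nonneg _)), Measure.real]

/-- If the maximal section volume `Q` is attained at two distinct heights
`k₋(Q) < k₊(Q)`, then all sections in between are translates of
`K₋ = K ∩ (k₋(Q)u + L)`, the middle part of `K` is the prism `K₋ + [0, λv]`,
and `K ⊆ K₋ + ℝv`. -/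
theorem max_section_prism (d : ℕ) (hd : 2 ≤ d)
    (u : EuclideanSpace ℝ (Fin d)) (hu : ‖u‖ = 1)
    (K : Set (EuclideanSpace ℝ (Fin d)))
    (hKc : IsCompact K) (hKcv : Convex ℝ K) (hKi : (interior K).Nonempty)
    (Q : ℝ) (hQ : IsGreatest (Set.range (sectionVol d K u)) Q)
    (kminQ kplusQ : ℝ)
    (hkmin : kminQ = sInf {q | Q ≤ sectionVol d K u q})
    (hkplus : kplusQ = sSup {q | Q ≤ sectionVol d K u q})
    (hlt : kminQ < kplusQ) :
    (∀ p ∈ Set.Icc kminQ kplusQ, ∃ w : EuclideanSpace ℝ (Fin d),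
        K ∩ {x | ⟪x, u⟫ = p} = w +ᵥ (K ∩ {x | ⟪x, u⟫ = kminQ})) ∧
      ∃ (v : EuclideanSpace ℝ (Fin d)) (lam : ℝ), ‖v‖ = 1 ∧ 0 < lam ∧ 0 < ⟪v, u⟫ ∧
        {x ∈ K | ⟪x, u⟫ ∈ Set.Icc kminQ kplusQ} =
          (K ∩ {x | ⟪x, u⟫ = kminQ}) + segment ℝ 0 (lam • v) ∧
        K ⊆ (K ∩ {x | ⟪x, u⟫ = kminQ}) + Set.range (fun t : ℝ => t • v) := by
  set μ : Measure (ℝ ∙ u)ᗮ := μH[Module.finrank ℝ (ℝ ∙ u)ᗮ]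
  set D : ℝ → Set (ℝ ∙ u)ᗮ := fun p => {y | p • u + (y : EuclideanSpace ℝ (Fin d)) ∈ K} with hDdef
  have hT := isCompact_setOf_smul_add_mem hu hKc
  have hvol : ∀ p, sectionVol d K u p = μ.real (D p) := sectionVol_eq_measureReal hu K
  have hDc : ∀ p, IsCompact (D p) := fun p =>
    (hT.image continuous_snd).of_isClosed_subset
      (hKc.isClosed.preimage (by fun_prop)) fun y hy => ⟨(p, y), hy, rfl⟩
  have hle : ∀ p, μ.real (D p) ≤ Q := fun p => hvol p ▸ hQ.2 ⟨p, rfl⟩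
  have hQ0 : 0 < Q := by
    obtain ⟨x, hx⟩ := hKi
    obtain ⟨y, hy⟩ := exists_eq_inner_smul_add hu x
    set p := ⟪x, u⟫
    have hopen : IsOpen {y : (ℝ ∙ u)ᗮ | p • u + (y : EuclideanSpace ℝ (Fin d)) ∈ interior K} :=
      isOpen_interior.preimage (by fun_prop)
    have hpos : 0 < μ (D p) := (hopen.measure_pos μ ⟨y, by rwa [Set.mem_ofPred_eq, ← hy]⟩).trans_le
      (measure_mono fun z hz => (interior_subset hz : p • u + (z : EuclideanSpace ℝ (Fin d)) ∈ K))
    exact (ENNReal.toReal_pos hpos.ne' (hDc p).measure_lt_top.ne).trans_le (hle p)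
  have hSclosed : IsClosed {q | Q ≤ sectionVol d K u q} := by
    simp only [hvol]
    exact isClosed_setOf_le_measureReal_section μ hT Q
  have hSne : {q | Q ≤ sectionVol d K u q}.Nonempty := by
    obtain ⟨q, hq⟩ := hQ.1
    exact ⟨q, hq.ge⟩
  have hSsub : {q | Q ≤ sectionVol d K u q} ⊆
      Prod.fst '' {z : ℝ × (ℝ ∙ u)ᗮ | z.1 • u + (z.2 : EuclideanSpace ℝ (Fin d)) ∈ K} := by
    intro q hq
    have hq' : Q ≤ μ.real (D q) := hvol q ▸ hq
    obtain ⟨y, hy⟩ : (D q).Nonempty := by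
      rw [Set.nonempty_iff_ne_empty]
      intro h
      rw [h, measureReal_empty] at hq'
      exact absurd hq' (not_le.2 hQ0)
    exact ⟨(q, y), hy, rfl⟩
  have hScpt := (hT.image continuous_fst).of_isClosed_subset hSclosed hSsub
  have hSmin := hScpt.sInf_mem hSne
  have hSmax := hScpt.sSup_mem hSne
  rw [← hkmin] at hSmin
  rw [← hkplus] at hSmax
  clear_value D
  obtain ⟨w, hw1, hw2⟩ := exists_prism_of_measure_le μ hDc (fun p q t ht0 ht1 y hy z hz => by
      simp only [hDdef, Set.mem_ofPred_eq] at hy hz ⊢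
      convert hKcv hy hz (sub_nonneg.2 ht1) ht0 (by ring) using 1
      push_cast
      module) hQ0 hle hlt (le_antisymm (hle _) (hvol _ ▸ hSmin))
    (le_antisymm (hle _) (hvol _ ▸ hSmax))
  set a := kminQ
  set b := kplusQ
  have hba : 0 < b - a := sub_pos.2 hlt
  set W : EuclideanSpace ℝ (Fin d) := (b - a) • u + w with hW
  have hWu : ⟪W, u⟫ = b - a := inner_smul_add_orthogonal hu _ w
  have hW0 : W ≠ 0 := by
    intro h
    rw [h, inner_zero_left] at hWu
    exact hba.ne hWu
  have hnW : 0 < ‖W‖ := norm_pos_iff.2 hW0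
  have up : ∀ z ∈ K ∩ {x | ⟪x, u⟫ = a}, ∀ r : ℝ, 0 ≤ r → r ≤ 1 → z + r • W ∈ K := by
    rintro z ⟨hz, hza⟩ r hr0 hr1
    obtain ⟨y, hy⟩ := exists_eq_inner_smul_add hu z
    rw [show ⟪z, u⟫ = a from hza] at hy
    have hyD : y ∈ D a := by rw [hDdef]; rwa [Set.mem_ofPred_eq, ← hy]
    have hmem : r • w +ᵥ y ∈ D (a + r * (b - a)) := by
      rw [hw1 _ ⟨by nlinarith, by nlinarith⟩, add_sub_cancel_left, mul_div_cancel_right₀ _ hba.ne']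
      exact Set.vadd_mem_vadd_set hyD
    rw [hDdef] at hmem
    simp only [Set.mem_ofPred_eq, vadd_eq_add] at hmem
    convert hmem using 1
    rw [hy, hW]
    push_cast
    module
  have down : ∀ x ∈ K, x - ((⟪x, u⟫ - a) / (b - a)) • W ∈ K ∩ {x | ⟪x, u⟫ = a} := by
    intro x hx
    obtain ⟨y, hy⟩ := exists_eq_inner_smul_add hu x
    set p := ⟪x, u⟫ with hp
    have hmem := hw2 p y (by rw [hDdef]; rwa [Set.mem_ofPred_eq, ← hy])
    have hr : (p - a) / (b - a) * (b - a) = p - a := div_mul_cancel₀ _ hba.ne'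
    rw [inter_inner_eq_image hu]
    refine ⟨_, by rwa [hDdef] at hmem, ?_⟩
    simp only
    rw [hW, smul_add, smul_smul, hr]
    refine Eq.trans ?_ (congrArg (· - _) hy.symm)
    push_cast
    module
  have height : ∀ z r, ⟪z, u⟫ = a → ⟪z + r • W, u⟫ = a + r * (b - a) := by
    intro z r hz
    rw [inner_add_left, real_inner_smul_left, hWu, hz]
  refine ⟨fun p hp => ⟨((p - a) / (b - a)) • W, ?_⟩, ‖W‖⁻¹ • W, ‖W‖, ?_, hnW, ?_, ?_, ?_⟩
  · have hr0 : 0 ≤ (p - a) / (b - a) := div_nonneg (sub_nonneg.2 hp.1) hba.le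
    have hr1 : (p - a) / (b - a) ≤ 1 := (div_le_one hba).2 (by linarith [hp.2])
    ext x
    constructor
    · rintro ⟨hx, hxp⟩
      have := down x hx
      rw [show ⟪x, u⟫ = p from hxp] at this
      exact ⟨_, this, by simp⟩
    · rintro ⟨z, hz, rfl⟩
      simp only [vadd_eq_add]
      rw [add_comm]
      refine ⟨up z hz _ hr0 hr1, ?_⟩
      rw [Set.mem_ofPred_eq, height z _ hz.2, div_mul_cancel₀ _ hba.ne']
      ring
  · rw [norm_smul, norm_inv, norm_norm, inv_mul_cancel₀ hnW.ne']
  · rw [real_inner_smul_left, hWu]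
    positivity
  · rw [smul_inv_smul₀ hnW.ne']
    ext x
    constructor
    · rintro ⟨hx, hxp⟩
      have hr0 : 0 ≤ (⟪x, u⟫ - a) / (b - a) := div_nonneg (sub_nonneg.2 hxp.1) hba.le
      have hr1 : (⟪x, u⟫ - a) / (b - a) ≤ 1 := (div_le_one hba).2 (by linarith [hxp.2])
      refine ⟨_, down x hx, ((⟪x, u⟫ - a) / (b - a)) • W, ?_, by simp⟩
      rw [segment_eq_image]
      exact ⟨_, ⟨hr0, hr1⟩, by simp⟩
    · rintro ⟨z, hz, _, hs, rfl⟩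
      rw [segment_eq_image] at hs
      obtain ⟨r, ⟨hr0, hr1⟩, rfl⟩ := hs
      simp only [smul_zero, zero_add]
      refine ⟨up z hz r hr0 hr1, ?_⟩
      rw [height z r hz.2]
      constructor <;> nlinarith
  · intro x hx
    refine ⟨_, down x hx, ((⟪x, u⟫ - a) / (b - a)) • W,
      ⟨(⟪x, u⟫ - a) / (b - a) * ‖W‖, ?_⟩, by simp⟩
    simp only
    rw [smul_smul, mul_assoc, mul_inv_cancel₀ hnW.ne', mul_one]
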